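/- arXiv:2505.00457 — 5 statements merged into one kernel-verified Lean document; each statement's English description precedes it below -/
import Mathlib

section
/- Let N be a positive integer, let ρ₀ and ρ₁ be density matrices on ℂ^N, and let α be a real number with 1 ≤ α < ∞. Then 2^(1-1/α) · T_α(ρ₀,ρ₁) ≤ T(ρ₀,ρ₁) ≤ 2 · (rank(ρ₀)^(1-α) + rank(ρ₁)^(1-α))^(-1/α) · T_α(ρ₀,ρ₁). -/
open Matrix
open scoped ComplexOrder

/-- The trace distance `T(ρ₀,ρ₁) = (1/2)·tr|ρ₀−ρ₁|`, where `|·|` is the matrix absolute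
value obtained by applying `x ↦ |x|` spectrally (continuous functional calculus). -/
noncomputable def traceDist {N : ℕ} (ρ₀ ρ₁ : Matrix (Fin N) (Fin N) ℂ) : ℝ :=
  2⁻¹ * (cfc (fun x : ℝ => |x|) (ρ₀ - ρ₁)).trace.re

/-- The quantum ℓ_α distance `T_α(ρ₀,ρ₁) = (1/2)·(tr(|ρ₀−ρ₁|^α))^(1/α)`. -/
noncomputable def lpDist {N : ℕ} (α : ℝ) (ρ₀ ρ₁ : Matrix (Fin N) (Fin N) ℂ) : ℝ :=
  2⁻¹ * ((cfc (fun x : ℝ => |x| ^ α) (ρ₀ - ρ₁)).trace.re) ^ (1 / α)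

/-- The trace of a function of a Hermitian matrix is the sum of its values at the eigenvalues. -/
theorem Matrix.IsHermitian.trace_cfc_re {n : Type*} [Fintype n] [DecidableEq n]
    {A : Matrix n n ℂ} (hA : A.IsHermitian) (f : ℝ → ℝ) :
    (cfc f A).trace.re = ∑ i, f (hA.eigenvalues i) := by
  rw [hA.cfc_eq, Matrix.IsHermitian.cfc, Unitary.conjStarAlgAut_apply, Matrix.trace_mul_cycle]
  simp [Matrix.trace_diagonal]

/-- If the compression of `A - B` to the range of `W` is positive definite and `B` is positive
semidefinite, then the number of columns of `W` is at most the rank of `A`. -/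
theorem Matrix.card_le_rank_of_posDef_sub {m n : Type*} [Fintype m] [DecidableEq m] [Fintype n]
    {A B : Matrix n n ℂ} (hB : B.PosSemidef) (W : Matrix n m ℂ)
    (h : (Wᴴ * (A - B) * W).PosDef) : Fintype.card m ≤ A.rank := by
  have hAW : (Wᴴ * A * W).PosDef := by
    have := h.add_posSemidef (hB.conjTranspose_mul_mul_same W)
    rwa [Matrix.mul_sub, Matrix.sub_mul, sub_add_cancel] at this
  rw [← Matrix.rank_of_isUnit _ hAW.isUnit]
  exact (Matrix.rank_mul_le_left _ _).trans (Matrix.rank_mul_le_right _ _)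

/-- The compression of a Hermitian matrix to a set of its eigenvectors is diagonal. -/
theorem Matrix.IsHermitian.compression_eq_diagonal {n : Type*} [Fintype n] [DecidableEq n]
    {A : Matrix n n ℂ} (hA : A.IsHermitian) (s : Finset n) :
    ((hA.eigenvectorUnitary : Matrix n n ℂ).submatrix id ((↑) : s → n))ᴴ * A *
        (hA.eigenvectorUnitary : Matrix n n ℂ).submatrix id ((↑) : s → n) =
      diagonal fun i : s => (hA.eigenvalues i : ℂ) := by
  have h := hA.conjStarAlgAut_star_eigenvectorUnitary
  rw [Unitary.conjStarAlgAut_star_apply] at h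
  have h' := congrArg (fun M => M.submatrix ((↑) : s → n) ((↑) : s → n)) h
  simp only [Matrix.submatrix_diagonal _ _ Subtype.val_injective] at h'
  exact h'

theorem Matrix.IsHermitian.card_pos_eigenvalues_le_rank {n : Type*} [Fintype n] [DecidableEq n]
    {A B : Matrix n n ℂ} (hB : B.PosSemidef) (hAB : (A - B).IsHermitian) :
    (Finset.univ.filter fun i => 0 < hAB.eigenvalues i).card ≤ A.rank := by
  rw [← Fintype.card_coe]
  refine Matrix.card_le_rank_of_posDef_sub hB
    ((hAB.eigenvectorUnitary : Matrix n n ℂ).submatrix id (↑)) ?_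
  rw [hAB.compression_eq_diagonal]
  refine Matrix.PosDef.diagonal fun i => ?_
  exact_mod_cast (Finset.mem_filter.mp i.2).2

theorem Matrix.IsHermitian.card_neg_eigenvalues_le_rank {n : Type*} [Fintype n] [DecidableEq n]
    {A B : Matrix n n ℂ} (hA : A.PosSemidef) (hAB : (A - B).IsHermitian) :
    (Finset.univ.filter fun i => hAB.eigenvalues i < 0).card ≤ B.rank := by
  rw [← Fintype.card_coe]
  refine Matrix.card_le_rank_of_posDef_sub hA
    ((hAB.eigenvectorUnitary : Matrix n n ℂ).submatrix id (↑)) ?_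
  rw [← neg_sub A B, Matrix.mul_neg, Matrix.neg_mul, hAB.compression_eq_diagonal,
    Matrix.diagonal_neg]
  refine Matrix.PosDef.diagonal fun i => ?_
  have hi := neg_pos.mpr (Finset.mem_filter.mp i.2).2
  exact_mod_cast hi

theorem Real.sum_rpow_le_rpow_sum {ι : Type*} (s : Finset ι) (f : ι → ℝ) {p : ℝ} (hp : 1 ≤ p)
    (hf : ∀ i ∈ s, 0 ≤ f i) : ∑ i ∈ s, f i ^ p ≤ (∑ i ∈ s, f i) ^ p := by
  have hsplit : ∀ x : ℝ, 0 ≤ x → x ^ p = x * x ^ (p - 1) := fun x hx => by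
    rw [← Real.rpow_one_add' hx (by linarith)]
    ring_nf
  rw [hsplit _ (Finset.sum_nonneg hf), Finset.sum_mul]
  refine Finset.sum_le_sum fun i hi => ?_
  rw [hsplit _ (hf i hi)]
  exact mul_le_mul_of_nonneg_left (Real.rpow_le_rpow (hf i hi)
    (Finset.single_le_sum hf hi) (by linarith)) (hf i hi)

theorem Real.rpow_mul_rpow_sum_le {ι : Type*} (s : Finset ι) (f : ι → ℝ) {p : ℝ} (hp : 1 ≤ p)
    (hf : ∀ i ∈ s, 0 ≤ f i) {r : ℕ} (hr : 0 < r) (hs : s.card ≤ r) :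
    (r : ℝ) ^ (1 - p) * (∑ i ∈ s, f i) ^ p ≤ ∑ i ∈ s, f i ^ p := by
  have hr' : (0 : ℝ) < r := by exact_mod_cast hr
  have hsum : 0 ≤ ∑ i ∈ s, f i ^ p := Finset.sum_nonneg fun i hi => Real.rpow_nonneg (hf i hi) _
  calc (r : ℝ) ^ (1 - p) * (∑ i ∈ s, f i) ^ p
      ≤ (r : ℝ) ^ (1 - p) * ((r : ℝ) ^ (p - 1) * ∑ i ∈ s, f i ^ p) := by
        gcongr
        refine (Real.rpow_sum_le_const_mul_sum_rpow_of_nonneg s hp hf).trans ?_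
        gcongr
    _ = ∑ i ∈ s, f i ^ p := by
        rw [← mul_assoc, ← Real.rpow_add hr']
        simp

theorem Finset.sum_abs_rpow_eq_pos_add_neg {ι : Type*} [Fintype ι] (f : ι → ℝ) {p : ℝ}
    (hp : p ≠ 0) :
    ∑ i, |f i| ^ p = ∑ i with 0 < f i, f i ^ p + ∑ i with f i < 0, (-f i) ^ p := by
  rw [Finset.sum_filter, Finset.sum_filter, ← Finset.sum_add_distrib]
  refine Finset.sum_congr rfl fun i _ => ?_
  rcases lt_trichotomy (f i) 0 with h | h | h
  · simp [h, h.not_gt, abs_of_neg]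
  · simp [h, hp]
  · simp [h, h.not_gt, abs_of_pos]

theorem Matrix.rank_pos_of_ne_zero {n : Type*} [Fintype n] [DecidableEq n]
    {A : Matrix n n ℂ} (hA : A ≠ 0) : 0 < A.rank := by
  rw [Nat.pos_iff_ne_zero]
  intro h
  rw [Matrix.rank, Submodule.finrank_eq_zero, LinearMap.range_eq_bot] at h
  exact hA (Matrix.ext_of_mulVec_single fun i => by
    rw [Matrix.zero_mulVec]
    exact LinearMap.congr_fun h (Pi.single i 1))

theorem lpDist_le_traceDist_le_rank_bound {N : ℕ} (hN : 0 < N)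
    (ρ₀ ρ₁ : Matrix (Fin N) (Fin N) ℂ)
    (h₀ : ρ₀.PosSemidef) (ht₀ : ρ₀.trace = 1)
    (h₁ : ρ₁.PosSemidef) (ht₁ : ρ₁.trace = 1)
    (α : ℝ) (hα : 1 ≤ α) :
    (2 : ℝ) ^ (1 - 1 / α) * lpDist α ρ₀ ρ₁ ≤ traceDist ρ₀ ρ₁ ∧
    traceDist ρ₀ ρ₁ ≤
      2 * ((ρ₀.rank : ℝ) ^ (1 - α) + (ρ₁.rank : ℝ) ^ (1 - α)) ^ (-(1 / α)) *
        lpDist α ρ₀ ρ₁ := by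
  have hA : (ρ₀ - ρ₁).IsHermitian := h₀.1.sub h₁.1
  have hα0 : 0 < α := by linarith
  have hr₀ : 0 < ρ₀.rank := Matrix.rank_pos_of_ne_zero fun h => by simp [h] at ht₀
  have hr₁ : 0 < ρ₁.rank := Matrix.rank_pos_of_ne_zero fun h => by simp [h] at ht₁
  have hc₀ := Matrix.IsHermitian.card_pos_eigenvalues_le_rank h₁ hA
  have hc₁ := Matrix.IsHermitian.card_neg_eigenvalues_le_rank h₀ hA
  have htr : ∑ i, hA.eigenvalues i = 0 := by
    have h := hA.trace_eq_sum_eigenvalues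
    rw [Matrix.trace_sub, ht₀, ht₁, sub_self] at h
    exact Complex.ofReal_injective (by push_cast; exact h.symm)
  unfold traceDist lpDist
  rw [hA.trace_cfc_re, hA.trace_cfc_re, Finset.sum_abs_rpow_eq_pos_add_neg _ hα0.ne']
  generalize hA.eigenvalues = l at *
  set t := ∑ i with 0 < l i, l i with ht
  have habs : ∑ i, |l i| = t + ∑ i with l i < 0, -l i := by
    simpa using Finset.sum_abs_rpow_eq_pos_add_neg l one_ne_zero
  have hneg : ∑ i with l i < 0, -l i = t := by
    have h : ∑ i, (|l i| - l i) = ∑ i with l i < 0, 2 * -l i := by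
      rw [Finset.sum_filter]
      refine Finset.sum_congr rfl fun i _ => ?_
      split_ifs with hi
      · rw [abs_of_neg hi]; ring
      · rw [abs_of_nonneg (not_lt.mp hi), sub_self]
    rw [Finset.sum_sub_distrib, ← Finset.mul_sum] at h
    linarith
  have hposn : ∀ i ∈ Finset.univ.filter fun i => 0 < l i, 0 ≤ l i := fun i hi =>
    (Finset.mem_filter.mp hi).2.le
  have hnegn : ∀ i ∈ Finset.univ.filter fun i => l i < 0, 0 ≤ -l i := fun i hi =>
    neg_nonneg.mpr (Finset.mem_filter.mp hi).2.le
  have ht0 : 0 ≤ t := Finset.sum_nonneg hposn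
  have hup₀ := Real.sum_rpow_le_rpow_sum _ _ hα hposn
  have hup₁ := Real.sum_rpow_le_rpow_sum _ _ hα hnegn
  have hlow₀ := Real.rpow_mul_rpow_sum_le _ _ hα hposn hr₀ hc₀
  have hlow₁ := Real.rpow_mul_rpow_sum_le _ _ hα hnegn hr₁ hc₁
  rw [habs, hneg]
  rw [hneg] at hup₁ hlow₁
  rw [← ht] at hup₀ hlow₀
  set S := ∑ i with 0 < l i, l i ^ α + ∑ i with l i < 0, (-l i) ^ α
  set K := (ρ₀.rank : ℝ) ^ (1 - α) + (ρ₁.rank : ℝ) ^ (1 - α) with hK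
  have hK0 : 0 < K := add_pos (Real.rpow_pos_of_pos (by exact_mod_cast hr₀) _)
    (Real.rpow_pos_of_pos (by exact_mod_cast hr₁) _)
  have hS : S ≤ 2 * t ^ α := by linarith
  have hKS : K * t ^ α ≤ S := by
    rw [hK, add_mul]
    exact add_le_add hlow₀ hlow₁
  have htα : 0 ≤ t ^ α := Real.rpow_nonneg ht0 α
  have hroot : ∀ c : ℝ, 0 ≤ c → (c * t ^ α) ^ (1 / α) = c ^ (1 / α) * t := fun c hc => by
    rw [Real.mul_rpow hc htα, ← Real.rpow_mul ht0, mul_one_div_cancel hα0.ne', Real.rpow_one]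
  have hS' : S ^ (1 / α) ≤ 2 ^ (1 / α) * t := by
    rw [← hroot 2 zero_le_two]
    exact Real.rpow_le_rpow ((by positivity : 0 ≤ K * t ^ α).trans hKS) hS (by positivity)
  have hKS' : K ^ (1 / α) * t ≤ S ^ (1 / α) := by
    rw [← hroot K hK0.le]
    exact Real.rpow_le_rpow (by positivity) hKS (by positivity)
  constructor
  · calc (2 : ℝ) ^ (1 - 1 / α) * (2⁻¹ * S ^ (1 / α))
        ≤ (2 : ℝ) ^ (1 - 1 / α) * (2⁻¹ * (2 ^ (1 / α) * t)) := by gcongr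
      _ = 2⁻¹ * (2 ^ (1 - 1 / α) * 2 ^ (1 / α) * t) := by ring
      _ = 2⁻¹ * (t + t) := by
        rw [← Real.rpow_add two_pos, sub_add_cancel, Real.rpow_one, two_mul]
  · calc 2⁻¹ * (t + t) = K ^ (-(1 / α)) * (K ^ (1 / α) * t) := by
          rw [← mul_assoc, ← Real.rpow_add hK0, neg_add_cancel, Real.rpow_zero]
          ring
      _ ≤ K ^ (-(1 / α)) * S ^ (1 / α) := by gcongr
      _ = 2 * K ^ (-(1 / α)) * (2⁻¹ * S ^ (1 / α)) := by ring
end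

section
/- Let N be a positive integer, let ρ₀ and ρ₁ be density matrices on ℂ^N, and let α be a real number with 1 ≤ α < ∞. Then 2^(1-1/α) · T_α(ρ₀,ρ₁) ≤ T(ρ₀,ρ₁) ≤ (2·max{rank(ρ₀), rank(ρ₁)})^(1-1/α) · T_α(ρ₀,ρ₁). -/
open Matrix
open scoped ComplexOrder

open Finset in
/-- If real numbers sum to zero, each is bounded in absolute value by half of the `ℓ₁` norm. -/
theorem two_mul_abs_le_sum_abs_of_sum_eq_zero {ι : Type*} {s : Finset ι} {f : ι → ℝ}
    (hf : ∑ i ∈ s, f i = 0) {i : ι} (hi : i ∈ s) : 2 * |f i| ≤ ∑ j ∈ s, |f j| := by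
  classical
  rw [← add_sum_erase s _ hi] at hf ⊢
  have h : |f i| ≤ ∑ j ∈ s.erase i, |f j| := by
    rw [eq_neg_of_add_eq_zero_left hf, abs_neg]
    exact abs_sum_le_sum_abs _ _
  linarith

/-- Real numbers summing to zero satisfy `∑ |f i| ^ p ≤ 2 (‖f‖₁ / 2) ^ p` for `p ≥ 1`. -/
theorem sum_abs_rpow_le_of_sum_eq_zero {ι : Type*} {s : Finset ι} {f : ι → ℝ}
    (hf : ∑ i ∈ s, f i = 0) {p : ℝ} (hp : 1 ≤ p) :
    ∑ i ∈ s, |f i| ^ p ≤ 2 * ((∑ i ∈ s, |f i|) / 2) ^ p := by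
  set T := (∑ i ∈ s, |f i|) / 2 with hT
  have hT0 : 0 ≤ T := by positivity
  have split_rpow : ∀ x : ℝ, 0 ≤ x → x ^ p = x * x ^ (p - 1) := fun x hx => by
    rw [← Real.rpow_one_add' hx (by linarith)]
    ring_nf
  calc ∑ i ∈ s, |f i| ^ p ≤ ∑ i ∈ s, |f i| * T ^ (p - 1) := by
        refine Finset.sum_le_sum fun i hi => ?_
        have h := two_mul_abs_le_sum_abs_of_sum_eq_zero hf hi
        rw [split_rpow _ (abs_nonneg _)]
        gcongr
        linarith
    _ = 2 * T ^ p := by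
        rw [← Finset.sum_mul, split_rpow T hT0, hT]
        ring

/-- Comparison of the `ℓ₁` and `ℓ_p` norms in terms of the size of the support. -/
theorem sum_abs_rpow_le_card_support {ι : Type*} [Fintype ι] (f : ι → ℝ) {p : ℝ} (hp : 1 ≤ p) :
    (∑ i, |f i|) ^ p ≤ (Fintype.card {i // f i ≠ 0} : ℝ) ^ (p - 1) * ∑ i, |f i| ^ p := by
  classical
  have h := Real.rpow_sum_le_const_mul_sum_rpow (Finset.univ.filter fun i => f i ≠ 0) f hp
  rw [Fintype.card_subtype]
  rw [Finset.sum_filter_of_ne (fun i _ hi => by simpa using hi),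
    Finset.sum_filter_of_ne] at h
  · exact h
  · intro i _ hi h0
    rw [h0, abs_zero, Real.zero_rpow (by linarith)] at hi
    exact hi rfl

namespace Matrix

theorem rank_add_le_rank_add_rank {m n K : Type*} [Fintype m] [Fintype n] [Field K]
    (A B : Matrix m n K) : (A + B).rank ≤ A.rank + B.rank := by
  rw [Matrix.rank, Matrix.rank, Matrix.rank, mulVecLin_add]
  exact (Submodule.finrank_mono (LinearMap.range_add_le A.mulVecLin B.mulVecLin)).trans
    (Submodule.finrank_add_le_finrank_add_finrank _ _)

theorem rank_neg_eq {m n K : Type*} [Fintype n] [Field K]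
    (A : Matrix m n K) : (-A).rank = A.rank := by
  have h : (-A).mulVecLin = -A.mulVecLin := by
    ext1
    simp
  rw [rank, rank, h, LinearMap.range_neg]

theorem rank_sub_le_rank_add_rank {m n K : Type*} [Fintype m] [Fintype n] [Field K]
    (A B : Matrix m n K) : (A - B).rank ≤ A.rank + B.rank := by
  rw [sub_eq_add_neg, ← rank_neg_eq B]
  exact rank_add_le_rank_add_rank A (-B)

theorem IsHermitian.re_trace_cfc {n 𝕜 : Type*} [RCLike 𝕜] [Fintype n] [DecidableEq n]
    {A : Matrix n n 𝕜} (hA : A.IsHermitian) (f : ℝ → ℝ) :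
    RCLike.re (_root_.cfc f A).trace = ∑ i, f (hA.eigenvalues i) := by
  rw [hA.cfc_eq, IsHermitian.cfc, Unitary.conjStarAlgAut_apply, trace_mul_cycle,
    Unitary.coe_star_mul_self, one_mul, trace_diagonal]
  simp

end Matrix

theorem lpDist_le_traceDist_le_maxRank_bound {N : ℕ} (hN : 0 < N)
    (ρ₀ ρ₁ : Matrix (Fin N) (Fin N) ℂ)
    (h₀ : ρ₀.PosSemidef) (ht₀ : ρ₀.trace = 1)
    (h₁ : ρ₁.PosSemidef) (ht₁ : ρ₁.trace = 1)
    (α : ℝ) (hα : 1 ≤ α) :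
    (2 : ℝ) ^ (1 - 1 / α) * lpDist α ρ₀ ρ₁ ≤ traceDist ρ₀ ρ₁ ∧
    traceDist ρ₀ ρ₁ ≤
      (2 * (max ρ₀.rank ρ₁.rank : ℕ) : ℝ) ^ (1 - 1 / α) * lpDist α ρ₀ ρ₁ := by
  have hA : (ρ₀ - ρ₁).IsHermitian := h₀.isHermitian.sub h₁.isHermitian
  have hsum : ∑ i, hA.eigenvalues i = 0 := by
    have h := hA.trace_eq_sum_eigenvalues
    rw [trace_sub, ht₀, ht₁, sub_self] at h
    rw [← RCLike.ofReal_sum] at h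
    exact RCLike.ofReal_eq_zero.mp h.symm
  have hrank : Fintype.card {i // hA.eigenvalues i ≠ 0} ≤ 2 * max ρ₀.rank ρ₁.rank := by
    rw [← hA.rank_eq_card_non_zero_eigs]
    have := rank_sub_le_rank_add_rank ρ₀ ρ₁
    omega
  have hα0 : 0 < α := by linarith
  have hinv : α * (1 / α) = 1 := mul_one_div_cancel hα0.ne'
  have hexp : (α - 1) * (1 / α) = 1 - 1 / α := by rw [sub_mul, hinv, one_mul]
  have htrace (f : ℝ → ℝ) : (cfc f (ρ₀ - ρ₁)).trace.re = ∑ i, f (hA.eigenvalues i) :=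
    hA.re_trace_cfc f
  rw [traceDist, lpDist, htrace, htrace]
  have hupper := sum_abs_rpow_le_card_support hA.eigenvalues hα
  have hlower := sum_abs_rpow_le_of_sum_eq_zero hsum hα
  set S := ∑ i, |hA.eigenvalues i|
  set P := ∑ i, |hA.eigenvalues i| ^ α
  have hS : 0 ≤ S := by positivity
  have hP : 0 ≤ P := by positivity
  constructor
  · have h : P ^ (1 / α) ≤ 2 ^ (1 / α) * (S / 2) := by
      calc P ^ (1 / α) ≤ (2 * (S / 2) ^ α) ^ (1 / α) := by gcongr
        _ = 2 ^ (1 / α) * (S / 2) := by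
          rw [Real.mul_rpow (by positivity) (by positivity), ← Real.rpow_mul (by positivity),
            hinv, Real.rpow_one]
    calc (2 : ℝ) ^ (1 - 1 / α) * (2⁻¹ * P ^ (1 / α))
        ≤ 2 ^ (1 - 1 / α) * (2⁻¹ * (2 ^ (1 / α) * (S / 2))) := by gcongr
      _ = (2 ^ (1 - 1 / α) * 2 ^ (1 / α)) * (2⁻¹ * (S / 2)) := by ring
      _ = 2⁻¹ * S := by
        rw [← Real.rpow_add two_pos, sub_add_cancel, Real.rpow_one]
        ring
  · have hrank' : (Fintype.card {i // hA.eigenvalues i ≠ 0} : ℝ)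
        ≤ 2 * (max ρ₀.rank ρ₁.rank : ℕ) := by exact_mod_cast hrank
    have h : S ≤ (2 * (max ρ₀.rank ρ₁.rank : ℕ) : ℝ) ^ (1 - 1 / α) * P ^ (1 / α) := by
      calc S = (S ^ α) ^ (1 / α) := by rw [← Real.rpow_mul hS, hinv, Real.rpow_one]
        _ ≤ ((2 * (max ρ₀.rank ρ₁.rank : ℕ) : ℝ) ^ (α - 1) * P) ^ (1 / α) := by
          gcongr
          refine hupper.trans ?_
          gcongr
        _ = (2 * (max ρ₀.rank ρ₁.rank : ℕ) : ℝ) ^ (1 - 1 / α) * P ^ (1 / α) := by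
          rw [Real.mul_rpow (by positivity) hP, ← Real.rpow_mul (by positivity), hexp]
    calc 2⁻¹ * S
        ≤ 2⁻¹ * ((2 * (max ρ₀.rank ρ₁.rank : ℕ) : ℝ) ^ (1 - 1 / α) * P ^ (1 / α)) := by gcongr
      _ = _ := by ring
end

section
/- Let ρ₀ and ρ₁ be density matrices on ℂ^N, and let ς₀ := (ρ₀ − ρ₁ + |ρ₀ − ρ₁|)/2 and ς₁ := (ρ₁ − ρ₀ + |ρ₀ − ρ₁|)/2 be the positive and negative parts of ρ₀ − ρ₁. Then rank(ς₀) ≤ rank(ρ₀) and rank(ς₁) ≤ rank(ρ₁). -/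
open Matrix
open scoped ComplexOrder

namespace Matrix

variable {n : Type*} [Fintype n]

/-- If every vector killed by `B` is killed by `A`, then `A` has rank at most that of `B`. -/
theorem rank_le_rank_of_mulVec_eq_zero {A B : Matrix n n ℂ}
    (h : ∀ v, B *ᵥ v = 0 → A *ᵥ v = 0) : A.rank ≤ B.rank := by
  have hker : LinearMap.ker B.mulVecLin ≤ LinearMap.ker A.mulVecLin := fun v hv => h v hv
  have hle := Submodule.finrank_mono hker
  have hA := A.mulVecLin.finrank_range_add_finrank_ker
  have hB := B.mulVecLin.finrank_range_add_finrank_ker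
  unfold Matrix.rank
  omega

/-- The first term of an orthogonal decomposition `P - Q` of a difference `A - B` of positive
semidefinite matrices has rank at most that of `A`. -/
theorem PosSemidef.rank_le_of_sub_eq_sub {A B P Q : Matrix n n ℂ} (hB : B.PosSemidef)
    (hP : P.PosSemidef) (hQP : Q * P = 0) (h : P - Q = A - B) : P.rank ≤ A.rank := by
  refine le_trans (rank_le_rank_of_mulVec_eq_zero fun v hv => ?_) (rank_mul_le_left A P)
  have hAw : A *ᵥ (P *ᵥ v) = 0 := by rwa [mulVec_mulVec]
  have hQw : Q *ᵥ (P *ᵥ v) = 0 := by rw [mulVec_mulVec, hQP, zero_mulVec]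
  have hPw : P *ᵥ (P *ᵥ v) = -(B *ᵥ (P *ᵥ v)) := by
    have := congrArg (· *ᵥ (P *ᵥ v)) h
    simpa only [sub_mulVec, hAw, hQw, sub_zero, zero_sub] using this
  have hBnonneg := hB.dotProduct_mulVec_nonneg (P *ᵥ v)
  have hPnonneg := hP.dotProduct_mulVec_nonneg (P *ᵥ v)
  have hzero : star (P *ᵥ v) ⬝ᵥ (P *ᵥ (P *ᵥ v)) = 0 := by
    refine le_antisymm ?_ hPnonneg
    rw [hPw, dotProduct_neg]
    exact neg_nonpos.mpr hBnonneg
  have hPP : P *ᵥ (P *ᵥ v) = 0 := (hP.dotProduct_mulVec_zero_iff _).mp hzero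
  rw [← dotProduct_star_self_eq_zero, star_mulVec, hP.isHermitian.eq,
    ← dotProduct_mulVec, hPP, dotProduct_zero]

variable [DecidableEq n]

theorem IsHermitian.half_smul_add_cfc_abs {A : Matrix n n ℂ} (hA : A.IsHermitian) :
    (2 : ℂ)⁻¹ • (A + cfc (fun x : ℝ => |x|) A) = cfc (fun x : ℝ => max x 0) A := by
  have hA' : IsSelfAdjoint A := hA
  have h : cfc (fun x : ℝ => x + |x|) A = A + cfc (fun x : ℝ => |x|) A := by
    rw [cfc_add .., cfc_id' ℝ A]
  have h2 : (2 : ℂ) • cfc (fun x : ℝ => max x 0) A = cfc (fun x : ℝ => x + |x|) A := by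
    rw [two_smul, ← cfc_add ..]
    congr 1
    funext x
    rcases le_total x 0 with hx | hx
    · simp [hx, abs_of_nonpos]
    · simp [hx, abs_of_nonneg]
  rw [← h, ← h2, smul_smul, inv_mul_cancel₀ two_ne_zero, one_smul]

theorem cfc_max_zero_posSemidef (A : Matrix n n ℂ) :
    (cfc (fun x : ℝ => max x 0) A).PosSemidef := by
  open scoped MatrixOrder in
  exact nonneg_iff_posSemidef.mp (cfc_nonneg fun x _ => le_max_right x 0)

/-- The positive part of a difference of positive semidefinite matrices has rank at most that
of the minuend. -/
theorem PosSemidef.rank_half_smul_sub_add_cfc_abs_le {A B : Matrix n n ℂ} (hA : A.PosSemidef)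
    (hB : B.PosSemidef) :
    ((2 : ℂ)⁻¹ • (A - B + cfc (fun x : ℝ => |x|) (A - B))).rank ≤ A.rank := by
  have hAB : (A - B).IsHermitian := hA.isHermitian.sub hB.isHermitian
  have hAB' : IsSelfAdjoint (A - B) := hAB
  rw [hAB.half_smul_add_cfc_abs]
  refine PosSemidef.rank_le_of_sub_eq_sub (Q := cfc (fun x : ℝ => max (-x) 0) (A - B)) hB
    (cfc_max_zero_posSemidef _) ?_ ?_
  · rw [← cfc_mul .., ← cfc_zero ℝ (A - B)]
    congr 1
    funext x
    rcases le_total x 0 with hx | hx <;> simp [hx]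
  · rw [← cfc_sub ..]
    conv_rhs => rw [← cfc_id' ℝ (A - B)]
    congr 1
    funext x
    rcases le_total x 0 with hx | hx <;> simp [hx]

theorem IsHermitian.cfc_abs_neg {A : Matrix n n ℂ} (hA : A.IsHermitian) :
    cfc (fun x : ℝ => |x|) (-A) = cfc (fun x : ℝ => |x|) A := by
  have hA' : IsSelfAdjoint A := hA
  rw [← cfc_comp_neg ..]
  simp only [abs_neg]

end Matrix

theorem rank_posPart_le_rank {N : ℕ}
    (ρ₀ ρ₁ : Matrix (Fin N) (Fin N) ℂ)
    (h₀ : ρ₀.PosSemidef) (ht₀ : ρ₀.trace = 1)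
    (h₁ : ρ₁.PosSemidef) (ht₁ : ρ₁.trace = 1) :
    ((2 : ℂ)⁻¹ • (ρ₀ - ρ₁ + cfc (fun x : ℝ => |x|) (ρ₀ - ρ₁))).rank ≤ ρ₀.rank ∧
    ((2 : ℂ)⁻¹ • (ρ₁ - ρ₀ + cfc (fun x : ℝ => |x|) (ρ₀ - ρ₁))).rank ≤ ρ₁.rank := by
  refine ⟨h₀.rank_half_smul_sub_add_cfc_abs_le h₁, ?_⟩
  rw [← neg_sub ρ₁ ρ₀, (h₁.isHermitian.sub h₀.isHermitian).cfc_abs_neg]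
  exact h₁.rank_half_smul_sub_add_cfc_abs_le h₀
end

section
/- For every real α > 0 there exist a constant C > 0 and ε₀ ∈ (0, 1/2] such that for every ε with 0 < ε < ε₀ there is a real polynomial P whose degree is at most C·ε^(−1/α), satisfying sup over x ∈ [−1,1] of |(1/2)·sgn(x)·|x|^α − P(x)| ≤ ε and sup over x ∈ [−1,1] of |P(x)| ≤ 1. -/
section Auxiliary

open MeasureTheory Set Polynomial

theorem exists_poly_taylor_sin (n : ℕ) :
    ∃ D : ℝ[X], D.natDegree ≤ n ∧ ∀ u : ℝ, 2 * |u| ≤ n →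
      |Real.sin u - u * D.eval u| ≤ 2 * (|u| ^ n / n.factorial) := by
  refine ⟨∑ j ∈ Finset.range (n - 1),
    C ((Complex.I ^ (j + 1)).im / (j + 1).factorial) * X ^ j, ?_, fun u hu => ?_⟩
  · refine natDegree_sum_le_of_forall_le _ _ fun j hj => ?_
    refine (natDegree_C_mul_X_pow_le _ _).trans ?_
    have := Finset.mem_range.1 hj
    omega
  · have h := Complex.exp_bound' (x := u * Complex.I) (n := n) (by
      rw [div_le_div_iff₀ (by positivity) (by norm_num)]
      simp only [Complex.norm_mul, Complex.norm_real, Real.norm_eq_abs, Complex.norm_I]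
      push_cast
      linarith)
    have h2 := (Complex.abs_im_le_norm _).trans h
    simp only [Complex.norm_mul, Complex.norm_real, Real.norm_eq_abs, Complex.norm_I,
      Complex.sub_im, Complex.exp_ofReal_mul_I_im, mul_one] at h2
    have key : (∑ m ∈ Finset.range n, ((u : ℂ) * Complex.I) ^ m / (m.factorial : ℂ)).im =
        u * (∑ j ∈ Finset.range (n - 1),
          C ((Complex.I ^ (j + 1)).im / (j + 1).factorial) * X ^ j : ℝ[X]).eval u := by
      have term (m : ℕ) : (((u : ℂ) * Complex.I) ^ m / (m.factorial : ℂ)).im =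
          u ^ m * ((Complex.I ^ m).im / m.factorial) := by
        rw [mul_pow, ← Complex.ofReal_pow, ← Complex.ofReal_natCast, Complex.div_ofReal_im,
          Complex.im_ofReal_mul, mul_div_assoc]
      rw [Complex.im_sum, eval_finsetSum, Finset.mul_sum]
      simp only [term, eval_mul, eval_C, eval_pow, eval_X]
      cases n with
      | zero => simp
      | succ k =>
        rw [Finset.sum_range_succ', Nat.add_sub_cancel]
        simp only [pow_zero, Complex.one_im, zero_div, mul_zero, add_zero]
        exact Finset.sum_congr rfl fun j _ => by ring
    rw [key] at h2
    linarith

theorem pow_div_factorial_le_one {N n : ℕ} (h : 3 * N ≤ n) :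
    (N : ℝ) ^ n / n.factorial ≤ 1 := by
  have h1 := Real.pow_div_factorial_le_exp (3 * N : ℝ) (by positivity) n
  have h2 : Real.exp (3 * N) ≤ 3 ^ n := by
    calc Real.exp (3 * N) = Real.exp 1 ^ (3 * N) := by
          rw [← Real.exp_nat_mul]; push_cast; ring_nf
      _ ≤ 3 ^ (3 * N) := by gcongr; exact Real.exp_one_lt_three.le
      _ ≤ 3 ^ n := by gcongr; norm_num
  rw [mul_pow, mul_div_assoc] at h1
  have h3 : (0 : ℝ) < 3 ^ n := by positivity
  nlinarith

theorem exists_poly_approx_sin_pow {N n : ℕ} (m : ℕ) (h : 3 * N ≤ n) :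
    ∃ B : ℝ[X], B.natDegree ≤ m * n ∧ ∀ u : ℝ, |u| ≤ N →
      |Real.sin u ^ m - u ^ m * B.eval u| ≤
        2 * m * 3 ^ (m - 1) * (|u| ^ n / n.factorial) := by
  obtain ⟨D, hD, hs⟩ := exists_poly_taylor_sin n
  refine ⟨D ^ m, natDegree_pow_le_of_le m hD, fun u hu => ?_⟩
  have hn : (3 * N : ℝ) ≤ n := by exact_mod_cast h
  have h1 := hs u (by linarith [abs_nonneg u])
  have h2 : |u| ^ n / n.factorial ≤ 1 :=
    le_trans (by gcongr) (pow_div_factorial_le_one h)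
  have h3 : |u * D.eval u| ≤ 3 := by
    have := Real.abs_sin_le_one u
    rw [abs_le] at *
    constructor <;> linarith [h1.1, h1.2]
  rw [eval_pow, ← mul_pow]
  refine (abs_pow_sub_pow_le _ _ _).trans ?_
  have h4 : max |Real.sin u| |u * D.eval u| ≤ 3 :=
    max_le ((Real.abs_sin_le_one u).trans (by norm_num)) h3
  calc _ ≤ 2 * (|u| ^ n / n.factorial) * m * 3 ^ (m - 1) := by gcongr
    _ = _ := by ring

theorem integrableOn_pow_mul_rpow {α : ℝ} {m : ℕ} (hm : α + 2 ≤ m) (N : ℝ) :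
    IntegrableOn (fun s : ℝ => s ^ m * s ^ (-(2 + α))) (Ioc 0 N) := by
  have h := (intervalIntegral.intervalIntegrable_rpow' (a := 0) (b := N)
    (r := m + (-(2 + α))) (by linarith)).1
  refine h.congr_fun (fun s hs => ?_) measurableSet_Ioc
  beta_reduce
  rw [Real.rpow_add hs.1, Real.rpow_natCast]

theorem setIntegral_pow_mul_rpow_le {α : ℝ} {m : ℕ} (hm : α + 2 ≤ m) {N : ℝ} (hN : 1 ≤ N) :
    ∫ s in Ioc 0 N, s ^ m * s ^ (-(2 + α)) ≤ N ^ m * N ^ (-α) := by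
  have hN0 : 0 < N := by linarith
  have h : ∫ s in Ioc 0 N, s ^ m * s ^ (-(2 + α)) = ∫ s in (0 : ℝ)..N, s ^ (m + (-(2 + α))) := by
    rw [intervalIntegral.integral_of_le hN0.le]
    refine setIntegral_congr_fun measurableSet_Ioc fun s hs => ?_
    rw [Real.rpow_add hs.1, Real.rpow_natCast]
  rw [h, integral_rpow (Or.inl (by linarith)), Real.zero_rpow (by linarith), sub_zero,
    ← Real.rpow_natCast, ← Real.rpow_add hN0]
  calc _ ≤ N ^ ((m : ℝ) + -(2 + α) + 1) :=
        div_le_self (by positivity) (by linarith)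
    _ ≤ _ := Real.rpow_le_rpow_of_exponent_le hN (by linarith)

theorem integrableOn_sin_pow_mul_rpow {α : ℝ} (hα : 0 < α) {m : ℕ} (hm : α + 2 ≤ m)
    (x : ℝ) :
    IntegrableOn (fun s : ℝ => Real.sin (x * s) ^ m * s ^ (-(2 + α))) (Ioi 0) := by
  have hmeas : Measurable (fun s : ℝ => Real.sin (x * s) ^ m * s ^ (-(2 + α))) := by
    fun_prop
  rw [← Ioc_union_Ioi_eq_Ioi (zero_le_one (α := ℝ))]
  refine IntegrableOn.union ?_ ?_
  · refine ((integrableOn_pow_mul_rpow hm 1).const_mul (|x| ^ m)).mono'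
      hmeas.aestronglyMeasurable ?_
    filter_upwards [ae_restrict_mem measurableSet_Ioc] with s hs
    have hs0 := hs.1
    rw [norm_mul, norm_pow, Real.norm_eq_abs, Real.norm_of_nonneg (by positivity), ← mul_assoc,
      ← mul_pow]
    have : |Real.sin (x * s)| ≤ |x| * s := by
      refine Real.abs_sin_le_abs.trans ?_
      rw [abs_mul, abs_of_pos hs0]
    gcongr
  · refine (integrableOn_Ioi_rpow_of_lt (a := -(2 + α)) (by linarith) zero_lt_one).mono'
      hmeas.aestronglyMeasurable ?_
    filter_upwards [ae_restrict_mem measurableSet_Ioi] with s hs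
    have hs0 : 0 < s := zero_lt_one.trans hs
    rw [norm_mul, norm_pow, Real.norm_eq_abs, Real.norm_of_nonneg (by positivity)]
    exact mul_le_of_le_one_left (by positivity)
      (pow_le_one₀ (abs_nonneg _) (Real.abs_sin_le_one _))

theorem setIntegral_sin_pow_mul_rpow_pos {α : ℝ} (hα : 0 < α) {m : ℕ} (hm : α + 2 ≤ m)
    (hme : Even m) :
    0 < ∫ s in Ioi (0 : ℝ), Real.sin s ^ m * s ^ (-(2 + α)) := by
  have hint := integrableOn_sin_pow_mul_rpow hα hm 1
  simp only [one_mul] at hint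
  have h1 : 0 < ∫ s in (0 : ℝ)..1, Real.sin s ^ m * s ^ (-(2 + α)) := by
    refine intervalIntegral.intervalIntegral_pos_of_pos_on ?_ (fun s hs => ?_) zero_lt_one
    · rw [intervalIntegrable_iff_integrableOn_Ioc_of_le zero_le_one]
      exact hint.mono_set Ioc_subset_Ioi_self
    · have := hs.1
      have := Real.sin_pos_of_pos_of_lt_pi hs.1 (by linarith [hs.2, Real.pi_gt_three])
      positivity
  rw [intervalIntegral.integral_of_le zero_le_one] at h1
  refine h1.trans_le (setIntegral_mono_set hint ?_ Ioc_subset_Ioi_self.eventuallyLE)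
  filter_upwards [ae_restrict_mem measurableSet_Ioi] with s hs
  exact mul_nonneg (hme.pow_nonneg _) (Real.rpow_nonneg (le_of_lt hs) _)

theorem setIntegral_sin_mul_pow_mul_rpow (α : ℝ) {m : ℕ} (hme : Even m) {x : ℝ} (hx : x ≠ 0) :
    ∫ s in Ioi (0 : ℝ), Real.sin (x * s) ^ m * s ^ (-(2 + α)) =
      x * (Real.sign x * |x| ^ α *
        ∫ s in Ioi (0 : ℝ), Real.sin s ^ m * s ^ (-(2 + α))) := by
  have hx' : 0 < |x| := abs_pos.2 hx
  have h := integral_comp_mul_left_Ioi (fun s : ℝ => Real.sin s ^ m * s ^ (-(2 + α))) 0 hx'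
  rw [mul_zero, smul_eq_mul] at h
  have h2 : ∫ s in Ioi (0 : ℝ), Real.sin (|x| * s) ^ m * (|x| * s) ^ (-(2 + α)) =
      |x| ^ (-(2 + α)) * ∫ s in Ioi (0 : ℝ), Real.sin (x * s) ^ m * s ^ (-(2 + α)) := by
    rw [← integral_const_mul]
    refine setIntegral_congr_fun measurableSet_Ioi fun s hs => ?_
    rw [Real.mul_rpow hx'.le (le_of_lt hs)]
    have : Real.sin (|x| * s) ^ m = Real.sin (x * s) ^ m := by
      rcases abs_choice x with h | h <;> rw [h]
      rw [neg_mul, Real.sin_neg, hme.neg_pow]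
    rw [this]; ring
  rw [h2] at h
  have h3 : x * Real.sign x = |x| := by
    rcases lt_or_gt_of_ne hx with h | h
    · rw [Real.sign_of_neg h, abs_of_neg h]; ring
    · rw [Real.sign_of_pos h, abs_of_pos h]; ring
  have h4 : |x| ^ (-(2 + α)) * (|x| * |x| * |x| ^ α) = 1 := by
    rw [Real.rpow_neg hx'.le, Real.rpow_add hx', Real.rpow_two]
    field_simp
  rw [← mul_assoc, ← mul_assoc, h3]
  set J := ∫ s in Ioi (0 : ℝ), Real.sin s ^ m * s ^ (-(2 + α))
  set I := ∫ s in Ioi (0 : ℝ), Real.sin (x * s) ^ m * s ^ (-(2 + α))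
  calc I = (|x| * |x| * |x| ^ α) * (|x| ^ (-(2 + α)) * I) := by linear_combination (-I) * h4
    _ = _ := by rw [h]; field_simp

theorem exists_poly_setIntegral {α : ℝ} {m : ℕ} (hm : α + 2 ≤ m) (hm2 : 2 ≤ m) (N : ℝ)
    (B : ℝ[X]) :
    ∃ P : ℝ[X], P.natDegree ≤ B.natDegree + m ∧ P.eval 0 = 0 ∧ ∀ x : ℝ,
      IntegrableOn (fun s => (x * s) ^ m * B.eval (x * s) * s ^ (-(2 + α))) (Ioc 0 N) ∧
      ∫ s in Ioc 0 N, (x * s) ^ m * B.eval (x * s) * s ^ (-(2 + α)) = x * P.eval x := by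
  have hint (j : ℕ) : IntegrableOn (fun s : ℝ => s ^ (j + m) * s ^ (-(2 + α))) (Ioc 0 N) := by
    refine integrableOn_pow_mul_rpow ?_ N
    push_cast
    linarith [(Nat.cast_nonneg j : (0 : ℝ) ≤ j)]
  have hfun (x : ℝ) : (fun s => (x * s) ^ m * B.eval (x * s) * s ^ (-(2 + α))) = fun s =>
      ∑ j ∈ Finset.range (B.natDegree + 1),
        B.coeff j * x ^ (j + m) * (s ^ (j + m) * s ^ (-(2 + α))) := by
    funext s
    rw [eval_eq_sum_range, Finset.mul_sum, Finset.sum_mul]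
    exact Finset.sum_congr rfl fun j _ => by ring
  refine ⟨∑ j ∈ Finset.range (B.natDegree + 1),
    C (B.coeff j * ∫ s in Ioc 0 N, s ^ (j + m) * s ^ (-(2 + α))) * X ^ (j + m - 1), ?_, ?_,
    fun x => ⟨?_, ?_⟩⟩
  · refine natDegree_sum_le_of_forall_le _ _ fun j hj => ?_
    refine (natDegree_C_mul_X_pow_le _ _).trans ?_
    have := Finset.mem_range.1 hj
    omega
  · rw [eval_finsetSum]
    refine Finset.sum_eq_zero fun j _ => ?_
    rw [eval_mul, eval_pow, eval_X, zero_pow (by omega), mul_zero]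
  · rw [hfun]
    exact integrable_finsetSum _ fun j _ => (hint j).const_mul _
  · rw [hfun, integral_finsetSum _ fun j _ => (hint j).const_mul _, eval_finsetSum,
      Finset.mul_sum]
    refine Finset.sum_congr rfl fun j _ => ?_
    rw [integral_const_mul, eval_mul, eval_C, eval_pow, eval_X]
    obtain ⟨k, hk⟩ : ∃ k, j + m = k + 1 := ⟨j + m - 1, by omega⟩
    rw [hk, Nat.add_sub_cancel]
    ring

theorem abs_setIntegral_Ioi_sin_pow_mul_rpow_le {α : ℝ} (hα : 0 < α) {m : ℕ} (hm : 1 ≤ m)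
    {N : ℝ} (hN : 0 < N) (x : ℝ) :
    |∫ s in Ioi N, Real.sin (x * s) ^ m * s ^ (-(2 + α))| ≤ |x| * (1 / α * N ^ (-α)) := by
  have h1 := (integrableOn_Ioi_rpow_of_lt (a := -(1 + α)) (by linarith) hN).const_mul |x|
  have h2 := norm_integral_le_of_norm_le h1
    (f := fun s : ℝ => Real.sin (x * s) ^ m * s ^ (-(2 + α))) (by
      filter_upwards [ae_restrict_mem measurableSet_Ioi] with s hs
      have hs0 : 0 < s := hN.trans hs
      rw [norm_mul, norm_pow, Real.norm_eq_abs, Real.norm_of_nonneg (by positivity)]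
      have h3 : |Real.sin (x * s)| ^ m ≤ |x| * s :=
        calc _ ≤ |Real.sin (x * s)| :=
              pow_le_of_le_one (abs_nonneg _) (Real.abs_sin_le_one _) (by omega)
          _ ≤ |x * s| := Real.abs_sin_le_abs
          _ = _ := by rw [abs_mul, abs_of_pos hs0]
      calc _ ≤ |x| * s * s ^ (-(2 + α)) := by gcongr
        _ = |x| * s ^ (-(1 + α)) := by
          rw [mul_assoc, show -(1 + α) = 1 + -(2 + α) by ring, Real.rpow_add hs0 1,
            Real.rpow_one])
  rw [integral_const_mul, integral_Ioi_rpow_of_lt (by linarith) hN,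
    show -(1 + α) + 1 = -α by ring, neg_div_neg_eq] at h2
  rw [one_div_mul_eq_div]
  exact h2

theorem exists_poly_approx_rate {α : ℝ} (hα : 0 < α) :
    ∃ K : ℕ, ∃ E > (0 : ℝ), ∀ N : ℕ, 1 ≤ N → ∃ P : ℝ[X], P.natDegree ≤ K * N ∧
      ∀ x : ℝ, |x| ≤ 1 → |2⁻¹ * Real.sign x * |x| ^ α - P.eval x| ≤ E * (N : ℝ) ^ (-α) := by
  obtain ⟨k, hk⟩ := exists_nat_ge (α + 2)
  obtain ⟨m, hme, hm⟩ : ∃ m : ℕ, Even m ∧ α + 2 ≤ m :=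
    ⟨2 * k, even_two_mul k, by push_cast; linarith [(Nat.cast_nonneg k : (0 : ℝ) ≤ k)]⟩
  have hm2 : 2 ≤ m := by
    have : (2 : ℝ) ≤ m := by linarith
    exact_mod_cast this
  have hJ := setIntegral_sin_pow_mul_rpow_pos hα hm hme
  set J := ∫ s in Ioi (0 : ℝ), Real.sin s ^ m * s ^ (-(2 + α)) with hJdef
  set M : ℝ := 2 * m * 3 ^ (m - 1) with hM
  have hM0 : 0 ≤ M := by positivity
  refine ⟨m * (3 + m) + m, (2 * J)⁻¹ * (M + 1 / α), by positivity, fun N hN => ?_⟩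
  have hN1 : (1 : ℝ) ≤ N := by exact_mod_cast hN
  have hN0 : (0 : ℝ) < N := by linarith
  obtain ⟨B, hB, hBs⟩ := exists_poly_approx_sin_pow (N := N) (n := 3 * N + m) m (by omega)
  set n := 3 * N + m with hn
  have hnα : α + 2 ≤ n := by
    rw [hn]; push_cast; linarith
  obtain ⟨P, hP, hP0, hPx⟩ := exists_poly_setIntegral hm hm2 N B
  refine ⟨C (2 * J)⁻¹ * P, ?_, fun x hx => ?_⟩
  · refine (natDegree_C_mul_le _ _).trans (hP.trans ?_)
    have : m ≤ m * N := Nat.le_mul_of_pos_right m hN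
    nlinarith
  rcases eq_or_ne x 0 with rfl | hx0
  · rw [eval_mul, hP0, Real.sign_zero]
    simp only [mul_zero, zero_mul, sub_zero, abs_zero]
    positivity
  obtain ⟨hQi, hQ⟩ := hPx x
  have hI := setIntegral_sin_mul_pow_mul_rpow α hme hx0
  rw [← hJdef] at hI
  have hSi := integrableOn_sin_pow_mul_rpow hα hm x
  have hhead : |(∫ s in Ioc 0 (N : ℝ), Real.sin (x * s) ^ m * s ^ (-(2 + α))) - x * P.eval x| ≤
      |x| * (M * (N : ℝ) ^ (-α)) := by
    rw [← hQ, ← integral_sub (hSi.mono_set Ioc_subset_Ioi_self) hQi]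
    have h := norm_integral_le_of_norm_le
      ((integrableOn_pow_mul_rpow hnα N).const_mul (|x| * (M / n.factorial)))
      (f := fun s : ℝ => Real.sin (x * s) ^ m * s ^ (-(2 + α)) -
        (x * s) ^ m * B.eval (x * s) * s ^ (-(2 + α))) (by
        filter_upwards [ae_restrict_mem measurableSet_Ioc] with s hs
        have hs0 := hs.1
        have hxs : |x * s| = |x| * s := by rw [abs_mul, abs_of_pos hs0]
        have h1 := hBs (x * s) (by
          rw [hxs]
          exact (mul_le_of_le_one_left hs0.le hx).trans hs.2)
        rw [← sub_mul, norm_mul, Real.norm_eq_abs, Real.norm_of_nonneg (by positivity)]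
        have h2 : |x * s| ^ n ≤ |x| * s ^ n := by
          rw [hxs, mul_pow]
          gcongr
          exact pow_le_of_le_one (abs_nonneg _) hx (by omega)
        calc _ ≤ M * (|x * s| ^ n / n.factorial) * s ^ (-(2 + α)) := by gcongr
          _ ≤ M * (|x| * s ^ n / n.factorial) * s ^ (-(2 + α)) := by gcongr
          _ = _ := by ring)
    rw [integral_const_mul] at h
    refine h.trans ?_
    calc _ ≤ |x| * (M / n.factorial) * ((N : ℝ) ^ n * (N : ℝ) ^ (-α)) := by
          gcongr
          exact setIntegral_pow_mul_rpow_le hnα hN1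
      _ = |x| * M * (N : ℝ) ^ (-α) * ((N : ℝ) ^ n / n.factorial) := by ring
      _ ≤ |x| * M * (N : ℝ) ^ (-α) * 1 := by
          gcongr
          exact pow_div_factorial_le_one (by omega)
      _ = _ := by ring
  have htail := abs_setIntegral_Ioi_sin_pow_mul_rpow_le hα (m := m) (by omega) hN0 x
  rw [← Ioc_union_Ioi_eq_Ioi hN0.le, setIntegral_union Ioc_disjoint_Ioi_same measurableSet_Ioi
    (hSi.mono_set Ioc_subset_Ioi_self) (hSi.mono_set (Ioi_subset_Ioi hN0.le))] at hI
  have hsum := (abs_add_le _ _).trans (add_le_add hhead htail)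
  have hx' : 0 < |x| := abs_pos.2 hx0
  rw [sub_add_eq_add_sub, hI, ← mul_sub, abs_mul, ← mul_add, mul_le_mul_iff_right₀ hx'] at hsum
  have heq : 2⁻¹ * Real.sign x * |x| ^ α - (C (2 * J)⁻¹ * P).eval x =
      (2 * J)⁻¹ * (Real.sign x * |x| ^ α * J - P.eval x) := by
    rw [eval_mul, eval_C]
    field_simp
  rw [heq, abs_mul, abs_of_pos (by positivity : 0 < (2 * J)⁻¹),
    mul_assoc (2 * J)⁻¹ (M + 1 / α), add_mul]
  gcongr


end Auxiliary

theorem exists_poly_approx_signed_power (α : ℝ) (hα : 0 < α) :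
    ∃ C > (0 : ℝ), ∃ ε₀ ∈ Set.Ioc (0 : ℝ) 2⁻¹, ∀ ε : ℝ, 0 < ε → ε < ε₀ →
      ∃ P : Polynomial ℝ,
        (P.natDegree : ℝ) ≤ C * ε ^ (-(1 / α)) ∧
        (∀ x ∈ Set.Icc (-1 : ℝ) 1,
          |2⁻¹ * Real.sign x * |x| ^ α - P.eval x| ≤ ε) ∧
        (∀ x ∈ Set.Icc (-1 : ℝ) 1, |P.eval x| ≤ 1) := by
  obtain ⟨K, E, hE, h⟩ := exists_poly_approx_rate hα
  set A : ℝ := max 1 (E ^ (1 / α)) with hA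
  have hA1 : 1 ≤ A := le_max_left _ _
  have hA0 : 0 < A := by linarith
  have hEA : E ≤ A ^ α := by
    calc E = (E ^ (1 / α)) ^ α := by
          rw [← Real.rpow_mul hE.le, one_div_mul_cancel hα.ne', Real.rpow_one]
      _ ≤ A ^ α := by gcongr; exact le_max_right _ _
  refine ⟨2 * A * (K + 1), by positivity, 2⁻¹, ⟨by norm_num, le_rfl⟩, fun ε hε hε2 => ?_⟩
  set t : ℝ := ε ^ (-(1 / α)) with ht
  have ht1 : 1 ≤ t :=
    Real.one_le_rpow_of_pos_of_le_one_of_nonpos hε (by linarith)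
      (neg_nonpos.2 (by positivity))
  have ht0 : 0 < t := by linarith
  have htα : t ^ (-α) = ε := by
    rw [ht, ← Real.rpow_mul hε.le, neg_mul_neg, one_div_mul_cancel hα.ne', Real.rpow_one]
  have hAt : 1 ≤ A * t := one_le_mul_of_one_le_of_one_le hA1 ht1
  set N : ℕ := ⌈A * t⌉₊ with hN
  have hNge : A * t ≤ N := Nat.le_ceil _
  have hNlt : (N : ℝ) < A * t + 1 := Nat.ceil_lt_add_one (by positivity)
  obtain ⟨P, hP, herr⟩ := h N (Nat.one_le_ceil_iff.2 (by positivity))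
  have hrate : E * (N : ℝ) ^ (-α) ≤ ε := by
    calc E * (N : ℝ) ^ (-α) ≤ A ^ α * (A * t) ^ (-α) := by
          gcongr ?_ * ?_
          exact Real.rpow_le_rpow_of_nonpos (by positivity) hNge (by linarith)
      _ = ε := by
          rw [Real.mul_rpow hA0.le ht0.le, htα, Real.rpow_neg hA0.le, ← mul_assoc,
            mul_inv_cancel₀ (by positivity), one_mul]
  have happ (x : ℝ) (hx : x ∈ Set.Icc (-1 : ℝ) 1) :
      |2⁻¹ * Real.sign x * |x| ^ α - P.eval x| ≤ ε :=
    (herr x (abs_le.2 hx)).trans hrate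
  refine ⟨P, ?_, happ, fun x hx => ?_⟩
  · calc (P.natDegree : ℝ) ≤ K * N := by exact_mod_cast hP
      _ ≤ (K + 1) * (2 * (A * t)) := by
          gcongr
          · linarith
          · linarith
      _ = _ := by ring
  · have h1 := happ x hx
    have h2 : |2⁻¹ * Real.sign x * |x| ^ α| ≤ 2⁻¹ := by
      have hs : |Real.sign x| ≤ 1 := by
        rcases Real.sign_apply_eq x with h | h | h <;> rw [h] <;> norm_num
      have hp : |x| ^ α ≤ 1 := Real.rpow_le_one (abs_nonneg _) (abs_le.2 hx) hα.le
      rw [abs_mul, abs_mul, abs_of_pos (by norm_num : (0 : ℝ) < 2⁻¹),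
        abs_of_nonneg (by positivity : 0 ≤ |x| ^ α), mul_assoc]
      exact mul_le_of_le_one_right (by norm_num) (mul_le_one₀ hs (by positivity) hp)
    rw [abs_le] at *
    constructor <;> linarith [h1.1, h1.2, h2.1, h2.2]
end

section
/- Let α > 0 be real and for each integer k ≥ 0 define c_k := (2/π)·∫_{−1}^{1} sgn(x)·|x|^α·T_k(x)/√(1−x²) dx, where T_k is the k-th Chebyshev polynomial of the first kind. Then: (a) c_k = 0 for every even k; (b) c₁ = (2/√π)·Γ((α+2)/2)/Γ((α+3)/2), where Γ is the Gamma function; and (c) for every integer l ≥ 1, c_{2l+1} = c_{2l−1}·(α − 2l + 1)/(α + 2l + 1). -/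
open Polynomial.Chebyshev MeasureTheory intervalIntegral

theorem sign_mul_abs_rpow_mul_self {α : ℝ} (hα : α + 1 ≠ 0) (x : ℝ) :
    Real.sign x * |x| ^ α * x = |x| ^ (α + 1) := by
  rcases lt_trichotomy x 0 with hx | rfl | hx
  · rw [Real.sign_of_neg hx, Real.rpow_add_one (abs_ne_zero.mpr hx.ne), abs_of_neg hx]
    ring
  · simp [Real.zero_rpow hα]
  · rw [Real.sign_of_pos hx, Real.rpow_add_one (abs_ne_zero.mpr hx.ne'), abs_of_pos hx]
    ring

theorem hasDerivAt_abs_rpow_add_one {α : ℝ} (hα : 0 < α) (x : ℝ) :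
    HasDerivAt (fun x : ℝ ↦ |x| ^ (α + 1)) ((α + 1) * (Real.sign x * |x| ^ α)) x := by
  convert! hasDerivAt_abs_rpow x (show 1 < α + 1 by linarith) using 1
  rw [mul_assoc]
  congr 1
  rcases lt_trichotomy x 0 with hx | rfl | hx
  · rw [Real.sign_of_neg hx, show α = α + 1 - 2 + 1 by ring,
      Real.rpow_add_one (abs_ne_zero.mpr hx.ne), abs_of_neg hx]
    ring_nf
  · simp
  · rw [Real.sign_of_pos hx, show α = α + 1 - 2 + 1 by ring,
      Real.rpow_add_one (abs_ne_zero.mpr hx.ne'), abs_of_pos hx]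
    ring_nf

theorem continuous_sign_mul_abs_rpow {α : ℝ} (hα : 0 < α) :
    Continuous fun x : ℝ ↦ Real.sign x * |x| ^ α := by
  have h : Continuous (deriv fun x : ℝ ↦ |x| ^ (α + 1)) :=
    (contDiff_norm_rpow (E := ℝ) (show 1 < α + 1 by linarith)).continuous_deriv le_rfl
  rw [funext fun x ↦ (hasDerivAt_abs_rpow_add_one hα x).deriv] at h
  simpa [← mul_assoc, show α + 1 ≠ 0 by linarith] using h.const_mul (α + 1)⁻¹

theorem integral_rpow_mul_one_sub_rpow {u v : ℝ} (hu : 0 < u) (hv : 0 < v) :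
    ∫ x in (0 : ℝ)..1, x ^ (u - 1) * (1 - x) ^ (v - 1) =
      Real.Gamma u * Real.Gamma v / Real.Gamma (u + v) := by
  have h : Complex.betaIntegral u v =
      ((∫ x in (0 : ℝ)..1, x ^ (u - 1) * (1 - x) ^ (v - 1) : ℝ) : ℂ) := by
    rw [Complex.betaIntegral, ← intervalIntegral.integral_ofReal]
    refine integral_congr fun x hx ↦ ?_
    rw [Set.uIcc_of_le zero_le_one] at hx
    push_cast [Complex.ofReal_cpow hx.1, Complex.ofReal_cpow (sub_nonneg.mpr hx.2)]
    rfl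
  have h' := ProbabilityTheory.beta_eq_betaIntegralReal u v hu hv
  rw [h, Complex.ofReal_re] at h'
  exact h'.symm

theorem integral_abs_rpow_mul_inv_sqrt_one_sub_sq {p : ℝ} (hp : 0 ≤ p) :
    ∫ x in (-1 : ℝ)..1, |x| ^ p * √(1 - x ^ 2)⁻¹ =
      √Real.pi * (Real.Gamma ((p + 1) / 2) / Real.Gamma ((p + 2) / 2)) := by
  have hint : IntervalIntegrable (fun x : ℝ ↦ |x| ^ p * √(1 - x ^ 2)⁻¹) volume (-1) 1 :=
    intervalIntegrable_sqrt_one_sub_sq_inv.continuousOn_mul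
      (continuous_abs.rpow_const fun _ ↦ Or.inr hp).continuousOn
  have hneg : ∫ x in (-1 : ℝ)..0, |x| ^ p * √(1 - x ^ 2)⁻¹ =
      ∫ x in (0 : ℝ)..1, |x| ^ p * √(1 - x ^ 2)⁻¹ := by
    have h := integral_comp_neg (a := (0 : ℝ)) (b := 1) fun x : ℝ ↦ |x| ^ p * √(1 - x ^ 2)⁻¹
    simp only [abs_neg, neg_sq, neg_zero] at h
    exact h.symm
  have hsub := integral_comp_mul_deriv_of_deriv_nonneg (a := 0) (b := 1) (f := fun x : ℝ ↦ x ^ 2)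
    (f' := fun x ↦ 2 * x) (g := fun x ↦ x ^ ((p + 1) / 2 - 1) * (1 - x) ^ ((1 / 2 : ℝ) - 1))
    (by fun_prop) (fun x _ ↦ by simpa using hasDerivAt_pow 2 x)
    (fun x hx ↦ by simp at hx; linarith [hx.1])
  have hbeta := integral_rpow_mul_one_sub_rpow (show 0 < (p + 1) / 2 by linarith)
    (show (0 : ℝ) < 1 / 2 by norm_num)
  rw [Real.Gamma_one_half_eq, show (p + 1) / 2 + 1 / 2 = (p + 2) / 2 by ring] at hbeta
  have hcongr : ∫ x in (0 : ℝ)..1,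
      ((fun x ↦ x ^ ((p + 1) / 2 - 1) * (1 - x) ^ ((1 / 2 : ℝ) - 1)) ∘ fun x : ℝ ↦ x ^ 2) x *
        (2 * x) = ∫ x in (0 : ℝ)..1, 2 * (|x| ^ p * √(1 - x ^ 2)⁻¹) := by
    refine integral_congr_Ioo_of_le zero_le_one fun x hx ↦ ?_
    have hx1 : 0 ≤ 1 - x ^ 2 := by nlinarith [hx.1, hx.2]
    have hpow : (x ^ 2) ^ ((p + 1) / 2 - 1) * x = x ^ p := by
      rw [← Real.rpow_natCast x 2, ← Real.rpow_mul hx.1.le, ← Real.rpow_add_one hx.1.ne']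
      push_cast
      ring_nf
    simp only [Function.comp_apply]
    rw [abs_of_pos hx.1, ← hpow, show (1 / 2 : ℝ) - 1 = -(1 / 2) by norm_num,
      Real.rpow_neg hx1, ← Real.sqrt_eq_rpow, Real.sqrt_inv]
    ring
  simp only [ne_eq, OfNat.ofNat_ne_zero, not_false_eq_true, zero_pow, one_pow] at hsub
  rw [hcongr, hbeta, intervalIntegral.integral_const_mul] at hsub
  have h0 : (0 : ℝ) ∈ Set.uIcc (-1) 1 := by
    rw [Set.uIcc_of_le (by norm_num)]; norm_num
  rw [← integral_add_adjacent_intervals (hint.mono_set (Set.uIcc_subset_uIcc_left h0))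
    (hint.mono_set (Set.uIcc_subset_uIcc_right h0)), hneg, ← two_mul, hsub]
  ring

theorem integral_mul_eval_T_div_sqrt (f : ℝ → ℝ) (n : ℤ) :
    ∫ x in (-1 : ℝ)..1, f x * (T ℝ n).eval x / √(1 - x ^ 2) =
      ∫ θ in (0 : ℝ)..Real.pi, f (Real.cos θ) * Real.cos (n * θ) := by
  simp_rw [div_eq_mul_inv, ← Real.sqrt_inv, ← integral_measureT fun x ↦ f x * (T ℝ n).eval x,
    integral_measureT_eq_integral_cos, T_real_cos]

theorem integral_sign_mul_abs_rpow_cos_recurrence {α : ℝ} (hα : 0 < α) (n : ℕ) :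
    (α + 1 + n) * ∫ θ in (0 : ℝ)..Real.pi,
        Real.sign (Real.cos θ) * |Real.cos θ| ^ α * Real.cos ((n + 1) * θ) =
      (α + 1 - n) * ∫ θ in (0 : ℝ)..Real.pi,
        Real.sign (Real.cos θ) * |Real.cos θ| ^ α * Real.cos ((n - 1) * θ) := by
  have hf : Continuous fun θ : ℝ ↦ Real.sign (Real.cos θ) * |Real.cos θ| ^ α :=
    (continuous_sign_mul_abs_rpow hα).comp Real.continuous_cos
  have hcont (m : ℝ) : Continuous fun θ : ℝ ↦
      Real.sign (Real.cos θ) * |Real.cos θ| ^ α * Real.cos (m * θ) := hf.mul (by fun_prop)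
  have hderiv (θ : ℝ) : HasDerivAt (fun θ : ℝ ↦ |Real.cos θ| ^ (α + 1) * Real.sin (n * θ))
      ((α + 1 + n) / 2 *
          (Real.sign (Real.cos θ) * |Real.cos θ| ^ α * Real.cos ((n + 1) * θ)) -
        (α + 1 - n) / 2 *
          (Real.sign (Real.cos θ) * |Real.cos θ| ^ α * Real.cos ((n - 1) * θ))) θ := by
    convert! ((hasDerivAt_abs_rpow_add_one hα (Real.cos θ)).comp θ (Real.hasDerivAt_cos θ)).mul
      (((hasDerivAt_id θ).const_mul (n : ℝ)).sin) using 1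
    simp only [Function.comp_apply, id_eq, add_mul, sub_mul, one_mul, Real.cos_add, Real.cos_sub,
      ← sign_mul_abs_rpow_mul_self (show α + 1 ≠ 0 by linarith)]
    ring
  have key := integral_eq_sub_of_hasDerivAt (a := 0) (b := Real.pi) (fun θ _ ↦ hderiv θ)
    ((((hcont _).const_mul _).sub ((hcont _).const_mul _)).intervalIntegrable _ _)
  rw [intervalIntegral.integral_sub (((hcont _).const_mul _).intervalIntegrable _ _)
    (((hcont _).const_mul _).intervalIntegrable _ _), intervalIntegral.integral_const_mul,
    intervalIntegral.integral_const_mul, Real.sin_nat_mul_pi] at key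
  simp only [mul_zero, Real.sin_zero] at key
  linarith

theorem chebyshev_coeffs_of_signed_power (α : ℝ) (hα : 0 < α) (c : ℕ → ℝ)
    (hc : ∀ k : ℕ, c k =
      (2 / Real.pi) * ∫ x in (-1 : ℝ)..1,
        Real.sign x * |x| ^ α * (Polynomial.Chebyshev.T ℝ (k : ℤ)).eval x /
          Real.sqrt (1 - x ^ 2)) :
    (∀ k : ℕ, Even k → c k = 0) ∧
    c 1 = (2 / Real.sqrt Real.pi) *
      (Real.Gamma ((α + 2) / 2) / Real.Gamma ((α + 3) / 2)) ∧
    (∀ l : ℕ, 1 ≤ l →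
      c (2 * l + 1) = c (2 * l - 1) * ((α - 2 * l + 1) / (α + 2 * l + 1))) := by
  refine ⟨fun k hk ↦ ?_, ?_, fun l hl ↦ ?_⟩
  · have h := integral_comp_neg (a := (-1 : ℝ)) (b := 1) fun x : ℝ ↦
      Real.sign x * |x| ^ α * (T ℝ (k : ℤ)).eval x / √(1 - x ^ 2)
    have hk' : Even (k : ℤ) := by exact_mod_cast hk
    simp only [Real.sign_neg, abs_neg, T_eval_neg, Int.negOnePow_even _ hk', even_two.neg_pow,
      Units.val_one, Int.cast_one, one_mul, neg_mul, neg_div, neg_neg,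
      intervalIntegral.integral_neg] at h
    rw [hc, show ∫ x in (-1 : ℝ)..1, Real.sign x * |x| ^ α * (T ℝ (k : ℤ)).eval x /
      √(1 - x ^ 2) = 0 by linarith, mul_zero]
  · have h := integral_abs_rpow_mul_inv_sqrt_one_sub_sq (show 0 ≤ α + 1 by linarith)
    rw [hc]
    simp only [Nat.cast_one, T_one, Polynomial.eval_X, sign_mul_abs_rpow_mul_self (show α + 1 ≠ 0 by linarith),
      div_eq_mul_inv, ← Real.sqrt_inv] at h ⊢
    rw [h, show α + 1 + 1 = α + 2 by ring, show α + 1 + 2 = α + 3 by ring, Real.sqrt_inv]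
    have hpi : √Real.pi ≠ 0 := by positivity
    nth_rewrite 1 [← Real.sq_sqrt Real.pi_pos.le]
    field_simp
  · have h := integral_sign_mul_abs_rpow_cos_recurrence hα (2 * l)
    have h2 : ((2 * l - 1 : ℕ) : ℝ) = 2 * l - 1 := by push_cast [show 1 ≤ 2 * l by lia]; ring
    rw [hc, hc, integral_mul_eval_T_div_sqrt, integral_mul_eval_T_div_sqrt]
    simp only [Int.cast_natCast, h2]
    push_cast at h ⊢
    have hpos : α + 2 * l + 1 ≠ 0 := by positivity
    field_simp
    linear_combination h
end
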